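/- Every representable operator S : L₁[0,1] → L₁[0,1] maps relatively weakly compact subsets of L₁[0,1] to totally bounded subsets of L₁[0,1]. In particular, if T₀ is a weakly compact operator on L₁[0,1], then S∘T₀ is a compact operator for every representable S. -/

import Mathlib

open scoped TensorProduct ENNReal
open MeasureTheory Filter

noncomputable section

/-- Lebesgue measure on `ℝ` restricted to the unit interval `[0,1]`. -/
def μ01 : Measure ℝ := volume.restrict (Set.Icc 0 1)

/-- The complex Lebesgue space `L₁[0,1]`. -/
abbrev L1C : Type := Lp ℂ 1 μ01

/-- An operator `T : L₁[0,1] → E` is representable if there is a bounded, strongly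
measurable `h : [0,1] → E` such that `T f = ∫₀¹ f(s) • h(s) ds` (a Bochner integral). -/
def IsRepresentable {E : Type*} [NormedAddCommGroup E] [NormedSpace ℂ E]
    (T : L1C →L[ℂ] E) : Prop :=
  ∃ h : ℝ → E, StronglyMeasurable h ∧ (∃ C : ℝ, ∀ t ∈ Set.Icc (0:ℝ) 1, ‖h t‖ ≤ C) ∧
    ∀ f : L1C, T f = ∫ s, (f : ℝ → ℂ) s • h s ∂μ01

/-- An operator between normed spaces is compact if it maps the closed unit ball to a
totally bounded set. -/
def CompactOp {E F : Type*} [NormedAddCommGroup E] [NormedSpace ℂ E]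
    [NormedAddCommGroup F] [NormedSpace ℂ F] (T : E →L[ℂ] F) : Prop :=
  TotallyBounded (Set.image (⇑T) (Metric.closedBall (0 : E) 1))

/-- An operator between normed spaces is weakly compact if the image of the closed unit ball
is relatively compact in the weak topology. -/
def WeaklyCompactOp {E F : Type*} [NormedAddCommGroup E] [NormedSpace ℂ E]
    [NormedAddCommGroup F] [NormedSpace ℂ F] (T : E →L[ℂ] F) : Prop :=
  IsCompact (closure (Set.image (⇑(toWeakSpace ℂ F)) (Set.image (⇑T) (Metric.closedBall (0 : E) 1))))

open Topology

/-- **Schur's theorem** for `ℓ¹`: a sequence of summable sequences which converges to zero against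
every bounded sequence converges to zero in `ℓ¹`-norm. -/
theorem tendsto_tsum_norm_of_tendsto_tsum_mul {x : ℕ → ℕ → ℂ}
    (hx : ∀ k, Summable fun i => ‖x k i‖)
    (h : ∀ a : ℕ → ℂ, (∀ i, ‖a i‖ ≤ 1) → Tendsto (fun k => ∑' i, a i * x k i) atTop (𝓝 0)) :
    Tendsto (fun k => ∑' i, ‖x k i‖) atTop (𝓝 0) := by
  have hsum : ∀ a : ℕ → ℂ, (∀ i, ‖a i‖ ≤ 1) → ∀ k, Summable fun i => a i * x k i := by
    intro a ha k
    refine Summable.of_norm_bounded (hx k) fun i => ?_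
    rw [norm_mul]
    exact mul_le_of_le_one_left (norm_nonneg _) (ha i)
  have hcoord : ∀ i, Tendsto (fun k => ‖x k i‖) atTop (𝓝 0) := by
    intro i
    have := (h (Pi.single i 1) fun j => by by_cases hj : j = i <;> simp [hj]).norm
    simpa [Pi.single_apply, tsum_ite_eq] using this
  rw [Metric.tendsto_atTop]
  intro ε hε
  let X := ℕ → Metric.closedBall (0 : ℂ) 1
  have hX : ∀ (a : X) i, ‖(a i : ℂ)‖ ≤ 1 := fun a i => mem_closedBall_zero_iff.mp (a i).2
  let F : ℕ → Set X := fun N => {a | ∀ k ≥ N, ‖∑' i, (a i : ℂ) * x k i‖ ≤ ε / 4}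
  have hclosed : ∀ N, IsClosed (F N) := by
    intro N
    have hF : F N = ⋂ k ≥ N, {a : X | ‖∑' i, (a i : ℂ) * x k i‖ ≤ ε / 4} := by
      ext a
      simp [F]
    rw [hF]
    refine isClosed_biInter fun k _ => isClosed_le (Continuous.norm ?_) continuous_const
    refine continuous_tsum (fun i => ?_) (hx k) fun i a => ?_
    · exact (continuous_subtype_val.comp (continuous_apply i)).mul continuous_const
    · rw [norm_mul]
      exact mul_le_of_le_one_left (norm_nonneg _) (hX a i)
  have hcover : ⋃ N, F N = Set.univ := by
    refine Set.eq_univ_of_forall fun a => Set.mem_iUnion.mpr ?_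
    obtain ⟨N, hN⟩ := Metric.tendsto_atTop.mp (h (fun i => a i) (hX a)) (ε / 4) (by positivity)
    exact ⟨N, fun k hk => by simpa using (hN k hk).le⟩
  obtain ⟨N, a₀, ha₀⟩ := nonempty_interior_of_iUnion_of_closed hclosed hcover
  obtain ⟨I, V, hV, hsub⟩ : ∃ (I : Finset ℕ) (V : ℕ → Set (Metric.closedBall (0 : ℂ) 1)),
      (∀ i, a₀ i ∈ V i) ∧ (I : Set ℕ).pi V ⊆ F N := by
    obtain ⟨I, V, hV, hsub⟩ := isOpen_pi_iff.mp isOpen_interior a₀ ha₀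
    refine ⟨I, fun i => if i ∈ I then V i else Set.univ, fun i => ?_, fun a ha => ?_⟩
    · by_cases hi : i ∈ I
      · simpa [hi] using (hV i hi).2
      · simp [hi]
    · refine interior_subset (hsub fun i hi => ?_)
      have := ha i hi
      simpa [Finset.mem_coe.mp hi] using this
  have hfin : Tendsto (fun k => ∑ i ∈ I, ‖x k i‖) atTop (𝓝 0) := by
    simpa using tendsto_finsetSum I fun i _ => hcoord i
  obtain ⟨M, hM⟩ := Metric.tendsto_atTop.mp hfin (ε / 4) (by positivity)
  refine ⟨max N M, fun k hk => ?_⟩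
  have hIk : ∑ i ∈ I, ‖x k i‖ < ε / 4 := by
    have := hM k (le_of_max_le_right hk)
    rw [Real.dist_eq, sub_zero] at this
    exact (le_abs_self _).trans_lt this
  choose c hc hcx using fun i => Complex.exists_norm_eq_mul_self (x k i)
  let b : X := fun i => if i ∈ I then a₀ i else ⟨c i, by simp [hc]⟩
  have hb : b ∈ F N := hsub fun i hi => by
    simpa [b, Finset.mem_coe.mp hi] using hV i
  have hbk := hb k (le_of_max_le_left hk)
  have hofReal : Summable fun i => (‖x k i‖ : ℂ) := Complex.ofRealCLM.summable (hx k)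
  have hsplit : ((∑' i, ‖x k i‖ : ℝ) : ℂ) - ∑' i, (b i : ℂ) * x k i
      = ∑ i ∈ I, ((‖x k i‖ : ℂ) - b i * x k i) := by
    rw [Complex.ofReal_tsum, ← hofReal.tsum_sub (hsum _ (hX b) k)]
    refine tsum_eq_sum fun i hi => ?_
    simp [b, hi, hcx]
  have hbound : ‖∑ i ∈ I, ((‖x k i‖ : ℂ) - b i * x k i)‖ ≤ 2 * ∑ i ∈ I, ‖x k i‖ := by
    rw [Finset.mul_sum]
    refine norm_sum_le_of_le _ fun i _ => (norm_sub_le _ _).trans ?_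
    rw [norm_mul, Complex.norm_real, norm_norm, two_mul]
    gcongr
    exact mul_le_of_le_one_left (norm_nonneg _) (hX b i)
  have htotal : ‖((∑' i, ‖x k i‖ : ℝ) : ℂ)‖ < ε := by
    have := norm_add_le (∑ i ∈ I, ((‖x k i‖ : ℂ) - b i * x k i)) (∑' i, (b i : ℂ) * x k i)
    rw [← hsplit, sub_add_cancel, hsplit] at this
    linarith
  rwa [dist_zero_right, ← Complex.norm_real]

/-- A strongly measurable function is a uniform limit of countably valued ones. -/
theorem exists_measurable_nat_dist_lt {α E : Type*} [MeasurableSpace α] [Nonempty α]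
    [PseudoMetricSpace E] {h : α → E} (hh : StronglyMeasurable h) {ε : ℝ} (hε : 0 < ε) :
    ∃ (n : α → ℕ) (y : ℕ → E), Measurable n ∧ (∀ i, y i ∈ Set.range h) ∧
      ∀ s, dist (h s) (y (n s)) < ε := by
  classical
  have : TopologicalSpace.SeparableSpace (Set.range h) := hh.isSeparable_range.separableSpace
  have : Nonempty (Set.range h) := (Set.range_nonempty h).to_subtype
  let y : ℕ → Set.range h := TopologicalSpace.denseSeq (Set.range h)
  have hex : ∀ s, ∃ i, dist (h s) (y i) < ε := fun s =>
    (TopologicalSpace.denseRange_denseSeq (Set.range h)).exists_dist_lt ⟨h s, s, rfl⟩ hε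
  refine ⟨fun s => Nat.find (hex s), fun i => y i, measurable_find hex fun i => ?_,
    fun i => (y i).2, fun s => Nat.find_spec (hex s)⟩
  exact measurableSet_lt (hh.dist stronglyMeasurable_const).measurable measurable_const

section Representable

variable {α E : Type*} [MeasurableSpace α] {μ : Measure α} [NormedAddCommGroup E] [NormedSpace ℂ E]

theorem integrable_Lp_smul {g : α → E} (hg : StronglyMeasurable g) {C : ℝ} (hC : ∀ s, ‖g s‖ ≤ C)
    (f : Lp ℂ 1 μ) : Integrable (fun s => f s • g s) μ :=
  (L1.integrable_coeFn f).smul_bdd C hg.aestronglyMeasurable (ae_of_all _ hC)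

theorem norm_integral_Lp_smul_le {g : α → E} {C : ℝ} (hC : ∀ s, ‖g s‖ ≤ C) (f : Lp ℂ 1 μ) :
    ‖∫ s, f s • g s ∂μ‖ ≤ C * ‖f‖ := by
  rw [L1.norm_eq_integral_norm, ← integral_const_mul]
  refine norm_integral_le_of_norm_le ((L1.integrable_coeFn f).norm.const_mul C)
    (ae_of_all _ fun s => ?_)
  rw [norm_smul, mul_comm]
  gcongr
  exact hC s

/-- The representable operator `f ↦ ∫ f • g` with a bounded strongly measurable kernel `g`. -/
def integralSMulCLM (μ : Measure α) (g : α → E) (hg : StronglyMeasurable g) (C : ℝ)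
    (hC : ∀ s, ‖g s‖ ≤ C) : Lp ℂ 1 μ →L[ℂ] E :=
  LinearMap.mkContinuous
    { toFun := fun f => ∫ s, f s • g s ∂μ
      map_add' := fun f₁ f₂ => by
        rw [← integral_add (integrable_Lp_smul hg hC f₁) (integrable_Lp_smul hg hC f₂)]
        refine integral_congr_ae ?_
        filter_upwards [Lp.coeFn_add f₁ f₂] with s hs
        rw [hs, Pi.add_apply, add_smul]
      map_smul' := fun c f => by
        rw [RingHom.id_apply, ← integral_smul]
        refine integral_congr_ae ?_
        filter_upwards [Lp.coeFn_smul c f] with s hs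
        rw [hs, Pi.smul_apply, smul_assoc] }
    C (norm_integral_Lp_smul_le hC)

@[simp]
theorem integralSMulCLM_apply (g : α → E) (hg : StronglyMeasurable g) (C : ℝ)
    (hC : ∀ s, ‖g s‖ ≤ C) (f : Lp ℂ 1 μ) :
    integralSMulCLM μ g hg C hC f = ∫ s, f s • g s ∂μ := rfl

theorem summable_norm_setIntegral_fiber {n : α → ℕ} (hn : Measurable n) (f : Lp ℂ 1 μ) :
    Summable fun i => ‖∫ s in n ⁻¹' {i}, f s ∂μ‖ := by
  have := (hasSum_integral_iUnion (fun i => hn (measurableSet_singleton i))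
    (pairwise_disjoint_fiber n) (L1.integrable_coeFn f).norm.integrableOn).summable
  exact this.of_nonneg_of_le (fun _ => norm_nonneg _) fun i => norm_integral_le_integral_norm _

theorem hasSum_setIntegral_fiber_smul [CompleteSpace E] {n : α → ℕ} (hn : Measurable n) {y : ℕ → E}
    {C : ℝ} (hC : ∀ i, ‖y i‖ ≤ C) (f : Lp ℂ 1 μ) :
    HasSum (fun i => (∫ s in n ⁻¹' {i}, f s ∂μ) • y i) (∫ s, f s • y (n s) ∂μ) := by
  have hy : StronglyMeasurable fun s => y (n s) :=
    (StronglyMeasurable.of_discrete (f := y)).comp_measurable hn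
  have := hasSum_integral_iUnion (fun i => hn (measurableSet_singleton i))
    (pairwise_disjoint_fiber n) (integrable_Lp_smul hy (fun s => hC (n s)) f).integrableOn
  rw [← Set.preimage_iUnion, Set.iUnion_of_singleton, Set.preimage_univ,
    Measure.restrict_univ] at this
  convert this using 2 with i
  rw [← integral_smul_const]
  exact setIntegral_congr_fun (hn (measurableSet_singleton i)) fun s hs => by
    simp only [Set.mem_preimage, Set.mem_singleton_iff] at hs
    simp [hs]

theorem continuous_dual_toWeakSpace_symm (ℓ : StrongDual ℂ E) :
    Continuous fun z : WeakSpace ℂ E => ℓ ((toWeakSpace ℂ E).symm z) :=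
  WeakBilin.eval_continuous _ ℓ

/-- On a weakly compact set, integration against a bounded countably valued kernel is sequentially
compact. -/
theorem isSeqCompact_image_integral_fiber [CompleteSpace E] {n : α → ℕ} (hn : Measurable n)
    {y : ℕ → E} {C : ℝ} (hC : ∀ i, ‖y i‖ ≤ C) {K : Set (Lp ℂ 1 μ)}
    (hK : IsCompact (toWeakSpace ℂ (Lp ℂ 1 μ) '' K)) :
    IsSeqCompact ((fun f : Lp ℂ 1 μ => ∫ s, f s • y (n s) ∂μ) '' K) := by
  intro u hu
  choose f hfK hfu using hu
  let φ : (a : ℕ → ℂ) → (∀ i, ‖a i‖ ≤ 1) → StrongDual ℂ (Lp ℂ 1 μ) := fun a ha =>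
    integralSMulCLM μ (fun s => a (n s))
      ((StronglyMeasurable.of_discrete (f := a)).comp_measurable hn) 1 fun s => ha (n s)
  have hφ : ∀ a ha g, φ a ha g = ∑' i, a i * ∫ s in n ⁻¹' {i}, g s ∂μ := fun a ha g => by
    simp only [φ, integralSMulCLM_apply]
    rw [← (hasSum_setIntegral_fiber_smul hn ha g).tsum_eq]
    simp only [smul_eq_mul, mul_comm]
  have hsingle : ∀ i j, ‖(Pi.single i 1 : ℕ → ℂ) j‖ ≤ 1 := fun i j => by
    by_cases hj : j = i <;> simp [hj]
  have hφ_single : ∀ i g, φ (Pi.single i 1) (hsingle i) g = ∫ s in n ⁻¹' {i}, g s ∂μ := by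
    intro i g
    rw [hφ, tsum_eq_single i]
    · simp
    · intro j hj
      simp [hj]
  have hcont : ∀ a ha, Continuous fun z : WeakSpace ℂ (Lp ℂ 1 μ) =>
      φ a ha ((toWeakSpace ℂ _).symm z) := fun a ha => continuous_dual_toWeakSpace_symm _
  obtain ⟨z, hzK, hz⟩ := hK.exists_mapClusterPt (f := atTop)
    (u := fun k => toWeakSpace ℂ (Lp ℂ 1 μ) (f k))
    (tendsto_principal.mpr (Eventually.of_forall fun k => Set.mem_image_of_mem _ (hfK k)))
  obtain ⟨f₀, hf₀, rfl⟩ := hzK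
  have hcluster := hz.continuousAt_comp
    (continuous_pi fun i => hcont (Pi.single i 1) (hsingle i)).continuousAt
  obtain ⟨ψ, hψ, hlim⟩ := hcluster.tendsto_subseq
  rw [tendsto_pi_nhds] at hlim
  have hweak : ∀ a ha, Tendsto (fun k => φ a ha (f (ψ k))) atTop (𝓝 (φ a ha f₀)) := by
    intro a ha
    rw [tendsto_iff_ultrafilter]
    intro U hU
    obtain ⟨_, ⟨g, hg, rfl⟩, hUg⟩ := hK.ultrafilter_le_nhds
      (U.map fun k => toWeakSpace ℂ (Lp ℂ 1 μ) (f (ψ k)))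
      (tendsto_principal.mpr (Eventually.of_forall fun k => Set.mem_image_of_mem _ (hfK (ψ k))))
    have hlimU : ∀ b hb, Tendsto (fun k => φ b hb (f (ψ k))) U (𝓝 (φ b hb g)) := fun b hb =>
      ((hcont b hb).tendsto _).comp hUg
    have hcoord : ∀ i, ∫ s in n ⁻¹' {i}, g s ∂μ = ∫ s in n ⁻¹' {i}, f₀ s ∂μ := fun i => by
      rw [← hφ_single, ← hφ_single]
      exact tendsto_nhds_unique (hlimU _ _) ((hlim i).mono_left hU)
    have heq : φ a ha g = φ a ha f₀ := by simp only [hφ, hcoord]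
    exact heq ▸ hlimU a ha
  refine ⟨_, Set.mem_image_of_mem _ hf₀, ψ, hψ, ?_⟩
  let d : ℕ → Lp ℂ 1 μ := fun k => f (ψ k) - f₀
  have hschur := tendsto_tsum_norm_of_tendsto_tsum_mul
    (x := fun k i => ∫ s in n ⁻¹' {i}, d k s ∂μ)
    (fun k => summable_norm_setIntegral_fiber hn _) fun a ha => by
      simp only [← hφ a ha, d, map_sub]
      simpa using (hweak a ha).sub_const (φ a ha f₀)
  rw [tendsto_iff_norm_sub_tendsto_zero]
  refine squeeze_zero (fun _ => norm_nonneg _) (fun k => ?_)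
    (by simpa using hschur.const_mul C)
  let G : Lp ℂ 1 μ →L[ℂ] E := integralSMulCLM μ (fun s => y (n s))
    ((StronglyMeasurable.of_discrete (f := y)).comp_measurable hn) C fun s => hC (n s)
  have hG : (u ∘ ψ) k - ∫ s, f₀ s • y (n s) ∂μ = G (d k) := by
    rw [map_sub, Function.comp_apply, ← hfu]
    rfl
  rw [hG, integralSMulCLM_apply, ← (hasSum_setIntegral_fiber_smul hn hC _).tsum_eq, ← tsum_mul_left]
  refine tsum_of_norm_bounded ((summable_norm_setIntegral_fiber hn _).mul_left C).hasSum fun i => ?_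
  rw [norm_smul, mul_comm]
  gcongr
  exact hC i

theorem exists_norm_le_of_isCompact_toWeakSpace_image {K : Set E}
    (hK : IsCompact (toWeakSpace ℂ E '' K)) : ∃ M, ∀ f ∈ K, ‖f‖ ≤ M := by
  obtain ⟨M, hM⟩ := banach_steinhaus
    (g := fun f : K => NormedSpace.inclusionInDoubleDual ℂ E f) fun ℓ => by
      obtain ⟨M, hM⟩ := hK.exists_bound_of_continuousOn
        (continuous_dual_toWeakSpace_symm ℓ).continuousOn
      exact ⟨M, fun f => hM _ (Set.mem_image_of_mem _ f.2)⟩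
  refine ⟨M, fun f hf => ?_⟩
  rw [← (NormedSpace.inclusionInDoubleDualLi (E := E) ℂ).norm_map f]
  exact hM ⟨f, hf⟩

theorem totallyBounded_image_integral_smul [CompleteSpace E] {h : α → E}
    (hh : StronglyMeasurable h) {C : ℝ} (hC : ∀ s, ‖h s‖ ≤ C) {K : Set (Lp ℂ 1 μ)}
    (hK : IsCompact (toWeakSpace ℂ (Lp ℂ 1 μ) '' K)) :
    TotallyBounded ((fun f : Lp ℂ 1 μ => ∫ s, f s • h s ∂μ) '' K) := by
  rcases isEmpty_or_nonempty α with hα | hα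
  · refine (Set.finite_singleton (0 : E)).totallyBounded.subset ?_
    rintro _ ⟨f, -, rfl⟩
    simp [Measure.eq_zero_of_isEmpty μ]
  obtain ⟨M, hM⟩ := exists_norm_le_of_isCompact_toWeakSpace_image hK
  rw [Metric.totallyBounded_iff]
  intro ε hε
  have hδ : 0 < ε / (2 * (|M| + 1)) := by positivity
  obtain ⟨n, y, hn, hy, hny⟩ := exists_measurable_nat_dist_lt hh hδ
  have hyC : ∀ i, ‖y i‖ ≤ C := fun i => by
    obtain ⟨s, hs⟩ := hy i
    exact hs ▸ hC s
  have hyn : StronglyMeasurable fun s => y (n s) :=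
    (StronglyMeasurable.of_discrete (f := y)).comp_measurable hn
  obtain ⟨t, ht, hcover⟩ := Metric.totallyBounded_iff.mp
    (isSeqCompact_image_integral_fiber hn hyC hK).totallyBounded (ε / 2) (by positivity)
  refine ⟨t, ht, ?_⟩
  rintro _ ⟨f, hf, rfl⟩
  obtain ⟨w, hw, hfw⟩ := Set.mem_iUnion₂.mp (hcover (Set.mem_image_of_mem _ hf))
  refine Set.mem_iUnion₂.mpr ⟨w, hw, ?_⟩
  have happrox : dist (∫ s, f s • h s ∂μ) (∫ s, f s • y (n s) ∂μ) ≤ ε / 2 := by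
    rw [dist_eq_norm, ← integral_sub (integrable_Lp_smul hh hC f)
      (integrable_Lp_smul hyn (fun s => hyC (n s)) f)]
    simp_rw [← smul_sub]
    refine (norm_integral_Lp_smul_le (fun s => (dist_eq_norm (h s) _ ▸ (hny s).le)) f).trans ?_
    have : ‖f‖ ≤ |M| + 1 := by linarith [hM f hf, le_abs_self M]
    calc ε / (2 * (|M| + 1)) * ‖f‖ ≤ ε / (2 * (|M| + 1)) * (|M| + 1) := by gcongr
      _ = ε / 2 := by field_simp
  have := dist_triangle (∫ s, f s • h s ∂μ) (∫ s, f s • y (n s) ∂μ) w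
  rw [Metric.mem_ball] at hfw ⊢
  linarith

end Representable

/-- Every representable operator `S` on `L₁[0,1]` maps relatively weakly compact sets to
totally bounded sets; in particular `S ∘ T₀` is compact whenever `T₀` is weakly compact. -/
theorem representable_maps_weakly_compact_to_totally_bounded
    (S : L1C →L[ℂ] L1C) (hS : IsRepresentable S) :
    (∀ K : Set L1C, IsCompact (closure (Set.image (⇑(toWeakSpace ℂ L1C)) K)) →
      TotallyBounded (Set.image (⇑S) K)) ∧
    (∀ T₀ : L1C →L[ℂ] L1C, WeaklyCompactOp T₀ → CompactOp (S.comp T₀)) := by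
  have main : ∀ K : Set L1C, IsCompact (closure (Set.image (⇑(toWeakSpace ℂ L1C)) K)) →
      TotallyBounded (Set.image (⇑S) K) := by
    intro K hK
    obtain ⟨h, hh, ⟨C, hC⟩, hSh⟩ := hS
    let g := (Set.Icc (0 : ℝ) 1).indicator h
    have hg : StronglyMeasurable g := hh.indicator measurableSet_Icc
    have hgC : ∀ s, ‖g s‖ ≤ C := fun s => by
      by_cases hs : s ∈ Set.Icc (0 : ℝ) 1
      · simpa [g, Set.indicator_of_mem hs] using hC s hs
      · simpa [g, Set.indicator_of_notMem hs] using
          (norm_nonneg _).trans (hC 0 (Set.left_mem_Icc.mpr zero_le_one))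
    have hSg : ∀ f : L1C, S f = ∫ s, f s • g s ∂μ01 := fun f => by
      rw [hSh f]
      exact setIntegral_congr_fun measurableSet_Icc fun s hs => by
        simp [g, Set.indicator_of_mem hs]
    have hK' : IsCompact (toWeakSpace ℂ L1C ''
        (toWeakSpace ℂ L1C ⁻¹' closure (toWeakSpace ℂ L1C '' K))) := by
      rwa [Set.image_preimage_eq _ (toWeakSpace ℂ L1C).surjective]
    refine (totallyBounded_image_integral_smul hg hgC hK').subset ?_
    rintro _ ⟨f, hf, rfl⟩
    exact ⟨f, Set.mem_preimage.mpr (subset_closure (Set.mem_image_of_mem _ hf)), (hSg f).symm⟩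
  refine ⟨main, fun T₀ hT₀ => ?_⟩
  have := main _ hT₀
  rwa [← Set.image_comp] at this
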